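/- arXiv:1008.2394 — 3 statements merged into one kernel-verified Lean document; each statement's English description precedes it below -/
import Mathlib

section
/- Let f : 𝕏 = ℙ^{n_1} × ⋯ × ℙ^{n_k} → ℙ^m be a morphism with multidegree (d_1, …, d_k). Then d_i = 0 for every index i with n_i > m. In particular, every morphism ℙ^n → ℙ^m with n > m is constant. -/
/-!
A morphism `f : 𝕏 = ℙ^{n 0} × ⋯ × ℙ^{n (k-1)} → ℙ^m` over an algebraically closed field `K`
of multidegree `(d 0, …, d (k-1))` (i.e. `f^*H = ∑ dᵢ Eᵢ`) is given by `m + 1` polynomials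
`F 0, …, F m` in the blocks of variables `X_i = (X_{i,0}, …, X_{i,n i})`, each
multihomogeneous of multidegree `d` (encoded via `IsWeightedHomogeneous` with the weight
of a variable in the `i`-th block equal to the `i`-th unit vector), having no common zero
on `𝕏`, i.e. no common zero `x` with all blocks `x i ≠ 0`.  Likewise a morphism
`ℙ^{n'} → ℙ^m` of degree `e` is given by `m + 1` homogeneous polynomials of degree `e`
with no common nontrivial zero, and it is constant iff the defining polynomials can be
taken to be constants.
-/

open MvPolynomial in
/-- Polynomials whose only common zero over an algebraically closed field is the origin are at
least as numerous as the variables. -/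
theorem MvPolynomial.card_le_card_of_eval_eq_zero_iff {K σ τ : Type*} [Field K] [IsAlgClosed K]
    [Finite σ] [Finite τ] (G : τ → MvPolynomial σ K)
    (hG : ∀ y : σ → K, (∀ j, eval y (G j) = 0) ↔ y = 0) : Nat.card σ ≤ Nat.card τ := by
  have key : ringKrullDim (MvPolynomial σ K) ≤ (Nat.card τ : ℕ∞) := by
    refine (ringKrullDim_le_iff_isMaximal_height_le _).mpr fun M hM ↦ ?_
    obtain ⟨a, rfl⟩ := isMaximal_iff_eq_vanishingIdeal_singleton.mp hM
    let T : τ → MvPolynomial σ K := fun j ↦ aeval (fun i ↦ X i - C (a i)) (G j)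
    have hT (x : σ → K) (j : τ) : eval x (T j) = eval (x - a) (G j) := by
      refine (eval₂Hom_bind₁ (RingHom.id K) x _ (G j)).trans ?_
      change eval (fun i ↦ eval x (X i - C (a i))) (G j) = _
      simp only [eval_sub, eval_X, eval_C]
      rfl
    have hz : zeroLocus K (Ideal.span (Set.range T)) = {a} := by
      ext x
      simp [zeroLocus_span, hT, hG, sub_eq_zero]
    have hmin : vanishingIdeal K {a} ∈ (Ideal.span (Set.range T)).minimalPrimes := by
      rw [← Ideal.radical_minimalPrimes, ← vanishingIdeal_zeroLocus_eq_radical (K := K), hz,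
        Ideal.minimalPrimes_eq_subsingleton_self]
      rfl
    have h := Ideal.height_le_card_of_mem_minimalPrimes_span (Set.finite_range T) hmin
    have hc : (Set.range T).ncard ≤ Nat.card τ := by
      rw [← Nat.card_coe_set_eq]
      exact Finite.card_range_le T
    exact_mod_cast h.trans (by exact_mod_cast hc)
  rw [ringKrullDim_of_isNoetherianRing, ringKrullDim_eq_zero_of_field, zero_add] at key
  exact_mod_cast key

open MvPolynomial in
/-- A multihomogeneous polynomial of positive degree in the `i`-th block of variables vanishes
wherever that block vanishes. -/
theorem MvPolynomial.IsWeightedHomogeneous.eval_eq_zero_of_block_eq_zero {R ι : Type*}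
    [CommSemiring R] [DecidableEq ι] {α : ι → Type*} {P : MvPolynomial (Σ i, α i) R} {d : ι → ℕ}
    (hP : P.IsWeightedHomogeneous (fun p : Σ i, α i ↦ Pi.single p.1 (1 : ℕ)) d)
    {i : ι} (hi : d i ≠ 0) {x : (Σ i, α i) → R} (hx : ∀ a, x ⟨i, a⟩ = 0) : eval x P = 0 := by
  rw [eval_eq]
  refine Finset.sum_eq_zero fun s hs ↦ ?_
  have hw := congrFun (hP (mem_support_iff.mp hs)) i
  rw [Finsupp.weight_apply, Finsupp.sum, Finset.sum_apply] at hw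
  obtain ⟨⟨l, a⟩, hp, hne⟩ := Finset.exists_ne_zero_of_sum_ne_zero (hw.trans_ne hi)
  obtain rfl : l = i := by
    by_contra h
    exact hne (by simp [Pi.single_eq_of_ne' h])
  rw [Finset.prod_eq_zero hp, mul_zero]
  rw [hx, zero_pow (Finsupp.mem_support_iff.mp hp)]

/-- Let `f : 𝕏 = ℙ^{n_1} × ⋯ × ℙ^{n_k} → ℙ^m` be a morphism with
multidegree `(d_1, …, d_k)`.  Then `d_i = 0` for every index `i` with `n_i > m`.
In particular, every morphism `ℙ^n → ℙ^m` with `n > m` is constant. -/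
theorem multidegree_eq_zero_of_dim_gt (K : Type*) [Field K] [IsAlgClosed K] {k m : ℕ}
    (n : Fin k → ℕ) (d : Fin k → ℕ)
    (F : Fin (m + 1) → MvPolynomial (Σ i : Fin k, Fin (n i + 1)) K)
    (homog : ∀ j, (F j).IsWeightedHomogeneous
      (fun p : Σ i : Fin k, Fin (n i + 1) => Pi.single p.1 (1 : ℕ)) d)
    (nonvanishing : ∀ x : (i : Fin k) → (Fin (n i + 1) → K), (∀ i, x i ≠ 0) →
      ∃ j, MvPolynomial.eval (fun p : Σ i : Fin k, Fin (n i + 1) => x p.1 p.2) (F j) ≠ 0) :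
    (∀ i : Fin k, m < n i → d i = 0) ∧
    -- in particular: every morphism `ℙ^{n'} → ℙ^m` with `n' > m` is constant
    (∀ (n' e : ℕ) (G : Fin (m + 1) → MvPolynomial (Fin (n' + 1)) K),
      (∀ j, (G j).IsHomogeneous e) →
      (∀ y : Fin (n' + 1) → K, y ≠ 0 → ∃ j, MvPolynomial.eval y (G j) ≠ 0) →
      m < n' → ∃ c : Fin (m + 1) → K, c ≠ 0 ∧ ∀ j, G j = MvPolynomial.C (c j)) := by
  classical
  refine ⟨fun i hi ↦ ?_, fun n' e G hG hy hn ↦ ?_⟩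
  · by_contra hd
    let g (p : Σ l : Fin k, Fin (n l + 1)) : MvPolynomial (Fin (n i + 1)) K :=
      Function.update (β := fun l ↦ Fin (n l + 1) → MvPolynomial (Fin (n i + 1)) K) 1 i
        MvPolynomial.X p.1 p.2
    let x (y : Fin (n i + 1) → K) : (l : Fin k) → Fin (n l + 1) → K := Function.update 1 i y
    have hg (y) (p : Σ l : Fin k, Fin (n l + 1)) :
        MvPolynomial.eval y (g p) = x y p.1 p.2 := by
      obtain ⟨l, a⟩ := p
      by_cases h : l = i
      · subst h
        simp [g, x]
      · simp [g, x, h]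
    have he (y j) : MvPolynomial.eval y (MvPolynomial.aeval g (F j)) =
        MvPolynomial.eval (fun p : Σ l : Fin k, Fin (n l + 1) ↦ x y p.1 p.2) (F j) := by
      refine (MvPolynomial.eval₂Hom_bind₁ (RingHom.id K) y g (F j)).trans ?_
      change MvPolynomial.eval (fun p ↦ MvPolynomial.eval y (g p)) (F j) = _
      simp only [hg]
    have := MvPolynomial.card_le_card_of_eval_eq_zero_iff
      (fun j ↦ MvPolynomial.aeval g (F j)) fun y ↦ by
        simp only [he]
        refine ⟨fun h ↦ ?_, fun h j ↦ ?_⟩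
        · by_contra hy
          obtain ⟨j, hj⟩ := nonvanishing (x y) fun l ↦ by
            by_cases h : l = i
            · subst h
              simpa [x] using hy
            · simp [x, h]
          exact hj (h j)
        · exact (homog j).eval_eq_zero_of_block_eq_zero hd fun a ↦ by simp [x, h]
    simp only [Nat.card_eq_fintype_card, Fintype.card_fin] at this
    omega
  · obtain rfl : e = 0 := by
      by_contra he
      have := MvPolynomial.card_le_card_of_eval_eq_zero_iff G fun y ↦ by
        refine ⟨fun h ↦ ?_, ?_⟩
        · by_contra h0
          obtain ⟨j, hj⟩ := hy y h0
          exact hj (h j)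
        · rintro rfl j
          rw [MvPolynomial.eval_zero]
          exact (hG j).coeff_eq_zero (by simpa using Ne.symm he)
      simp only [Nat.card_eq_fintype_card, Fintype.card_fin] at this
      omega
    have hC (j) : G j = MvPolynomial.C ((G j).coeff 0) :=
      MvPolynomial.totalDegree_eq_zero_iff_eq_C.mp (Nat.le_zero.mp (hG j).totalDegree_le)
    refine ⟨fun j ↦ (G j).coeff 0, fun h ↦ ?_, hC⟩
    obtain ⟨j, hj⟩ := hy 1 one_ne_zero
    rw [hC j, MvPolynomial.eval_C] at hj
    exact hj (congrFun h j)
end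

section
/- Let 𝕐 = (ℙⁿ)^l and let ψ : 𝕐 → 𝕐 be a dominant endomorphism. Then there exists a natural number N ≥ 1 such that (ψ^N)* is a diagonal matrix in the basis E_1, …, E_l; that is, (ψ^N)*E_i = c_i E_i for positive integers c_i. -/
open MvPolynomial

/-- The set of points of `𝕐 = (ℙⁿ)^l` over `K`. -/
abbrev MPoint (K : Type*) [Field K] (n l : ℕ) :=
  Fin l → Projectivization K (Fin (n + 1) → K)

/-- Evaluation of a polynomial at (the chosen representatives of) a point of `(ℙⁿ)^l`. -/
noncomputable def evalAt (K : Type*) [Field K] {n l : ℕ} (x : MPoint K n l)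
    (f : MvPolynomial (Fin l × Fin (n + 1)) K) : K :=
  eval (fun p : Fin l × Fin (n + 1) => (x p.1).rep p.2) f

/-- Zariski-closed subsets of `(ℙⁿ)^l`: common zero loci of families of multihomogeneous
polynomials. -/
def ZariskiClosed (K : Type*) [Field K] {n l : ℕ} (S : Set (MPoint K n l)) : Prop :=
  ∃ 𝔉 : Set (MvPolynomial (Fin l × Fin (n + 1)) K),
    (∀ f ∈ 𝔉, ∃ d : Fin l → ℕ,
      f.IsWeightedHomogeneous (fun p : Fin l × Fin (n + 1) => Pi.single p.1 (1 : ℕ)) d) ∧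
    S = {x : MPoint K n l | ∀ f ∈ 𝔉, evalAt K x f = 0}

/-- A subset of `(ℙⁿ)^l` is Zariski dense if the only Zariski-closed set containing it is
the whole space. -/
def ZariskiDense (K : Type*) [Field K] {n l : ℕ} (T : Set (MPoint K n l)) : Prop :=
  ∀ S : Set (MPoint K n l), ZariskiClosed K S → T ⊆ S → S = Set.univ

/-- The endomorphism of `(ℙⁿ)^l` induced by a tuple of multihomogeneous polynomial
components with no common zero. -/
noncomputable def inducedMap (K : Type*) [Field K] {n l : ℕ}
    (F : Fin l → Fin (n + 1) → MvPolynomial (Fin l × Fin (n + 1)) K)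
    (hF : ∀ x : Fin l → (Fin (n + 1) → K), (∀ i, x i ≠ 0) → ∀ i,
      ∃ j, eval (fun p : Fin l × Fin (n + 1) => x p.1 p.2) (F i j) ≠ 0) :
    MPoint K n l → MPoint K n l :=
  fun x i =>
    Projectivization.mk K (fun j => evalAt K x (F i j)) (by
      obtain ⟨j, hj⟩ := hF (fun i => (x i).rep) (fun i => (x i).rep_nonzero) i
      intro hzero
      exact hj (by simpa [evalAt] using congrFun hzero j))

/-- The weights giving the `k`-th block of variables of `MvPolynomial (ι × κ) R` the degree
`Pi.single k 1`. -/
abbrev blockWeight (ι κ : Type*) [DecidableEq ι] : ι × κ → ι → ℕ :=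
  fun p => Pi.single p.1 1

theorem eval_bind₁_eq {σ τ K : Type*} [Field K] (x : τ → K) (g : σ → MvPolynomial τ K)
    (f : MvPolynomial σ K) : eval x (bind₁ g f) = eval (fun s => eval x (g s)) f := by
  rw [← coe_aeval_eq_eval, ← coe_aeval_eq_eval]
  exact aeval_bind₁ _ _ _

section Multihomogeneous

variable {ι κ ι' κ' : Type*} [DecidableEq ι] [Fintype ι] [Fintype κ] [DecidableEq ι']
  {K : Type*} [Field K]

theorem weight_blockWeight_apply (e : ι × κ →₀ ℕ) (k : ι) :
    Finsupp.weight (blockWeight ι κ) e k = ∑ j, e (k, j) := by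
  classical
  rw [Finsupp.weight_apply, Finsupp.sum_fintype _ _ (by simp), Finset.sum_apply,
    Fintype.sum_prod_type, Finset.sum_eq_single k]
  · simp
  · intro b _ hb
    simp [Ne.symm hb]
  · simp

theorem eval_mul_block {f : MvPolynomial (ι × κ) K} {D : ι → ℕ}
    (hf : f.IsWeightedHomogeneous (blockWeight ι κ) D) (t : ι → K) (x : ι × κ → K) :
    eval (fun p => t p.1 * x p) f = (∏ k, t k ^ D k) * eval x f := by
  rw [eval_eq', eval_eq', Finset.mul_sum]
  refine Finset.sum_congr rfl fun e he => ?_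
  have hw := hf (mem_support_iff.mp he)
  have : ∏ k, t k ^ D k = ∏ p : ι × κ, t p.1 ^ e p := by
    rw [Fintype.prod_prod_type]
    refine Finset.prod_congr rfl fun k _ => ?_
    rw [← hw, weight_blockWeight_apply]
    exact (Finset.prod_pow_eq_pow_sum _ _ _).symm
  rw [this]
  simp only [mul_pow, Finset.prod_mul_distrib]
  ring

theorem eval_congr_of_block {f : MvPolynomial (ι × κ) K} {D : ι → ℕ}
    (hf : f.IsWeightedHomogeneous (blockWeight ι κ) D) {x y : ι × κ → K}
    (h : ∀ p, D p.1 ≠ 0 → x p = y p) : eval x f = eval y f := by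
  rw [eval_eq', eval_eq']
  refine Finset.sum_congr rfl fun e he => ?_
  have hw := hf (mem_support_iff.mp he)
  congr 1
  refine Finset.prod_congr rfl fun p _ => ?_
  by_cases hp : D p.1 = 0
  · rw [← hw, weight_blockWeight_apply, Finset.sum_eq_zero_iff] at hp
    simp [hp p.2 (Finset.mem_univ _)]
  · rw [h p hp]

theorem isWeightedHomogeneous_bind₁ {f : MvPolynomial (ι × κ) K} {D : ι → ℕ}
    (hf : f.IsWeightedHomogeneous (blockWeight ι κ) D) {E : ι → ι' → ℕ}
    {g : ι × κ → MvPolynomial (ι' × κ') K}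
    (hg : ∀ p, (g p).IsWeightedHomogeneous (blockWeight ι' κ') (E p.1)) :
    (bind₁ g f).IsWeightedHomogeneous (blockWeight ι' κ') (∑ k, D k • E k) := by
  rw [f.as_sum, map_sum]
  refine IsWeightedHomogeneous.sum _ _ _ fun e he => ?_
  have hw := hf (mem_support_iff.mp he)
  rw [bind₁_monomial]
  have h1 : (∏ p ∈ e.support, g p ^ e p).IsWeightedHomogeneous (blockWeight ι' κ')
      (∑ p ∈ e.support, e p • E p.1) :=
    IsWeightedHomogeneous.prod _ _ _ fun p _ => (hg p).pow _
  have h2 : ∑ p ∈ e.support, e p • E p.1 = ∑ k, D k • E k := by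
    rw [Finset.sum_subset (Finset.subset_univ e.support)
      (fun p _ hp => by simp [Finsupp.notMem_support_iff.mp hp]), Fintype.sum_prod_type]
    refine Finset.sum_congr rfl fun k _ => ?_
    rw [← hw, weight_blockWeight_apply, Finset.sum_smul]
  rw [← h2]
  exact h1.C_mul _

/-- A multihomogeneous polynomial is determined by its values on one affine chart. -/
theorem eq_zero_of_eval_chart [Infinite K] {f : MvPolynomial (ι × κ) K} {D : ι → ℕ}
    (hf : f.IsWeightedHomogeneous (blockWeight ι κ) D) (j₀ : κ)
    (h : ∀ x : ι × κ → K, (∀ k, x (k, j₀) = 1) → eval x f = 0) : f = 0 := by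
  have hprod : f * ∏ k, X (k, j₀) = 0 := by
    refine MvPolynomial.funext fun x => ?_
    rw [map_mul, map_prod, map_zero]
    by_cases hx : ∀ k, x (k, j₀) ≠ 0
    · have h1 := eval_mul_block hf (fun k => x (k, j₀)) (fun p => (x (p.1, j₀))⁻¹ * x p)
      rw [h (fun p => (x (p.1, j₀))⁻¹ * x p) (fun k => inv_mul_cancel₀ (hx k)), mul_zero] at h1
      simp only [mul_inv_cancel_left₀ (hx _)] at h1
      rw [show eval x f = 0 from h1, zero_mul]
    · push Not at hx
      obtain ⟨k, hk⟩ := hx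
      rw [Finset.prod_eq_zero (Finset.mem_univ k) (by simpa using hk), mul_zero]
  exact (mul_eq_zero.mp hprod).resolve_right (Finset.prod_ne_zero_iff.mpr fun k _ => X_ne_zero _)

end Multihomogeneous

section Finiteness

variable {ι κ γ : Type*} [DecidableEq ι] [Fintype ι] [Fintype κ]
  {K : Type*} [Field K]

theorem weightedHomogeneousComponent_mul_of_left {σ M : Type*} [AddCancelCommMonoid M]
    {w : σ → M} {f g : MvPolynomial σ K} {m n : M} (hf : f.IsWeightedHomogeneous w m) :
    weightedHomogeneousComponent w (m + n) (f * g) = f * weightedHomogeneousComponent w n g := by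
  classical
  let _ := weightedGradedAlgebra K w
  have h := DirectSum.coe_decompose_mul_add_of_left_mem (weightedHomogeneousSubmodule K w)
    (i := m) (j := n) (a := f) (b := g) hf
  have e : ∀ (p : MvPolynomial σ K) (i : M),
      (DirectSum.decompose (weightedHomogeneousSubmodule K w) p i : MvPolynomial σ K) =
        weightedHomogeneousComponent w i p :=
    fun p i => weightedDecomposition.decompose'_apply K w p i
  rwa [e, e] at h

/-- The exponent of the monomial `∏ k, X (k, c k)`, over those `k` with `D k ≠ 0`. -/
noncomputable def sectionExponent (D : ι → ℕ) (c : ι → κ) : ι × κ →₀ ℕ := by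
  classical
  exact Finsupp.equivFunOnFinite.symm fun p => if D p.1 ≠ 0 ∧ p.2 = c p.1 then 1 else 0

variable [IsAlgClosed K] {D : ι → ℕ} {G : γ → MvPolynomial (ι × κ) K}

theorem monomial_sectionExponent_mem_radical [Nonempty κ]
    (hG : ∀ j, (G j).IsWeightedHomogeneous (blockWeight ι κ) D)
    (hG0 : ∀ x : ι → κ → K, (∀ i, x i ≠ 0) → ∃ j, eval (fun p => x p.1 p.2) (G j) ≠ 0)
    (c : ι → κ) :
    monomial (sectionExponent D c) (1 : K) ∈ (Ideal.span (Set.range G)).radical := by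
  classical
  rw [← vanishingIdeal_zeroLocus_eq_radical (K := K), mem_vanishingIdeal_iff]
  intro z hz
  rw [zeroLocus_span] at hz
  by_contra hne
  have hne' : ∀ k, D k ≠ 0 → z (k, c k) ≠ 0 := by
    intro k hk h0
    apply hne
    rw [aeval_monomial, Finsupp.prod_fintype _ _ (by simp)]
    rw [Finset.prod_eq_zero (Finset.mem_univ (k, c k)), mul_zero]
    simp [sectionExponent, hk, h0]
  obtain ⟨j, hj⟩ := hG0 (fun k a => if D k ≠ 0 then z (k, a) else 1) (by
    intro k h0
    by_cases hk : D k = 0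
    · have := congrFun h0 (Classical.arbitrary κ)
      simp [hk] at this
    · have := congrFun h0 (c k)
      simp only [ne_eq, hk, not_false_eq_true, if_true, Pi.zero_apply] at this
      exact hne' k hk this)
  apply hj
  rw [eval_congr_of_block (hG j) (y := z) (fun p hp => by simp [hp])]
  rw [← coe_aeval_eq_eval]
  exact hz (G j) ⟨j, rfl⟩

theorem exists_forall_mem_span_range [Nonempty κ]
    (hG : ∀ j, (G j).IsWeightedHomogeneous (blockWeight ι κ) D)
    (hG0 : ∀ x : ι → κ → K, (∀ i, x i ≠ 0) → ∃ j, eval (fun p => x p.1 p.2) (G j) ≠ 0) :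
    ∃ m₀ : ℕ, ∀ m, m₀ ≤ m → ∀ f : MvPolynomial (ι × κ) K,
      f.IsWeightedHomogeneous (blockWeight ι κ) (m • D) → f ∈ Ideal.span (Set.range G) := by
  classical
  choose s hs using fun c => monomial_sectionExponent_mem_radical hG hG0 c
  set S := ∑ c, s c with hS
  refine ⟨Fintype.card κ * S, fun m hm f hf => ?_⟩
  rw [f.as_sum]
  refine Ideal.sum_mem _ fun e he => ?_
  have hw := hf (mem_support_iff.mp he)
  have hex : ∀ k, ∃ a, D k ≠ 0 → S ≤ e (k, a) := by
    intro k
    by_cases hk : D k = 0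
    · exact ⟨Classical.arbitrary κ, fun h => absurd hk h⟩
    · have h1 : ∑ a : κ, S ≤ ∑ a, e (k, a) := by
        rw [← weight_blockWeight_apply, hw]
        simp only [Finset.sum_const, Finset.card_univ, Pi.smul_apply, smul_eq_mul]
        exact hm.trans (Nat.le_mul_of_pos_right _ (Nat.pos_of_ne_zero hk))
      obtain ⟨a, _, ha⟩ := Finset.exists_le_of_sum_le Finset.univ_nonempty h1
      exact ⟨a, fun _ => ha⟩
  choose c hc using hex
  have hsc : s c ≤ S := Finset.single_le_sum (f := s) (fun _ _ => Nat.zero_le _) (Finset.mem_univ c)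
  have hle : s c • sectionExponent D c ≤ e := by
    intro p
    by_cases hp : D p.1 ≠ 0 ∧ p.2 = c p.1
    · have := hc p.1 hp.1
      rw [← hp.2] at this
      simpa [sectionExponent, hp.1, ← hp.2] using hsc.trans this
    · simp [sectionExponent, hp]
  have hmon : monomial e (coeff e f) =
      monomial (e - s c • sectionExponent D c) (coeff e f) *
        monomial (sectionExponent D c) (1 : K) ^ s c := by
    rw [monomial_pow, monomial_mul, one_pow, mul_one, tsub_add_cancel_of_le hle]
  rw [hmon]
  exact Ideal.mul_mem_left _ _ (hs c)

/-- Forms of degree `D` are integral over the algebra generated by forms of degree `D` without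
common zeros on the product of projective spaces. -/
theorem isIntegral_adjoin_of_isWeightedHomogeneous [Finite γ] [Nonempty κ]
    (hG : ∀ j, (G j).IsWeightedHomogeneous (blockWeight ι κ) D)
    (hG0 : ∀ x : ι → κ → K, (∀ i, x i ≠ 0) → ∃ j, eval (fun p => x p.1 p.2) (G j) ≠ 0)
    {u : MvPolynomial (ι × κ) K} (hu : u.IsWeightedHomogeneous (blockWeight ι κ) D) :
    IsIntegral (Algebra.adjoin K (Set.range G)) u := by
  classical
  have := Fintype.ofFinite γ
  obtain ⟨m₀, hm₀⟩ := exists_forall_mem_span_range hG hG0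
  set A := Algebra.adjoin K (Set.range G) with hA
  let B : Set (MvPolynomial (ι × κ) K) :=
    ⋃ m ∈ Finset.range (m₀ + 1), (fun e => monomial e (1 : K)) ''
      {e | Finsupp.weight (blockWeight ι κ) e = m • D}
  have hB : B.Finite := by
    refine Set.Finite.biUnion (Finset.finite_toSet _) fun m _ => Set.Finite.image _ ?_
    refine (Set.finite_Iic (Finsupp.equivFunOnFinite.symm
      (fun p : ι × κ => m * D p.1))).subset ?_
    rintro e he ⟨k, a⟩
    have := congrFun he k
    rw [weight_blockWeight_apply] at this
    simp only [Finsupp.equivFunOnFinite_symm_apply_apply]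
    simp only [Pi.smul_apply, smul_eq_mul] at this
    rw [← this]
    exact Finset.single_le_sum (f := fun a => e (k, a)) (fun _ _ => Nat.zero_le _)
      (Finset.mem_univ a)
  let N : Submodule A (MvPolynomial (ι × κ) K) := Submodule.span A B
  have hsmall : ∀ m, m < m₀ + 1 → ∀ f : MvPolynomial (ι × κ) K,
      f.IsWeightedHomogeneous (blockWeight ι κ) (m • D) → f ∈ N := by
    intro m hm f hf
    rw [f.as_sum]
    refine N.sum_mem fun e he => ?_
    have hmem : monomial e (1 : K) ∈ N := by
      refine Submodule.subset_span ?_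
      simp only [B, Set.mem_iUnion]
      exact ⟨m, Finset.mem_range.mpr hm, e, hf (mem_support_iff.mp he), rfl⟩
    have := N.smul_mem (algebraMap K A (coeff e f)) hmem
    rwa [algebraMap_smul, smul_monomial, smul_eq_mul, mul_one] at this
  have hN : ∀ (m : ℕ) (f : MvPolynomial (ι × κ) K),
      f.IsWeightedHomogeneous (blockWeight ι κ) (m • D) → f ∈ N := by
    intro m
    induction m with
    | zero => exact fun f hf => hsmall 0 (Nat.succ_pos _) f hf
    | succ m ih =>
      intro f hf
      rcases lt_or_ge (m + 1) (m₀ + 1) with hm | hm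
      · exact hsmall _ hm f hf
      obtain ⟨c, hc⟩ := (Ideal.mem_span_range_iff_exists_fun).mp
        (hm₀ (m + 1) (by omega) f hf)
      have hf' : f = ∑ j, G j * weightedHomogeneousComponent (blockWeight ι κ) (m • D) (c j) := by
        rw [← hf.weightedHomogeneousComponent_same, ← hc, map_sum]
        refine Finset.sum_congr rfl fun j _ => ?_
        rw [mul_comm, add_smul, one_smul, add_comm, weightedHomogeneousComponent_mul_of_left (hG j)]
      rw [hf']
      refine N.sum_mem fun j _ => ?_
      exact N.smul_mem (⟨G j, Algebra.subset_adjoin ⟨j, rfl⟩⟩ : A)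
        (ih _ (weightedHomogeneousComponent_isWeightedHomogeneous _ _))
  refine isIntegral_of_smul_mem_submodule N ?_ (Submodule.fg_span hB) u ?_
  · intro h
    have h1 := hN 0 1 (by rw [zero_smul]; exact isWeightedHomogeneous_one K _)
    rw [h, Submodule.mem_bot] at h1
    exact one_ne_zero h1
  · intro f hf
    induction hf using Submodule.span_induction with
    | mem x hx =>
      simp only [B, Set.mem_iUnion] at hx
      obtain ⟨m, _, e, he, rfl⟩ := hx
      refine hN (m + 1) _ ?_
      rw [add_smul, one_smul, add_comm]
      exact hu.mul (isWeightedHomogeneous_monomial _ _ _ he)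
    | zero => simp
    | add x y _ _ hx hy => rw [smul_add]; exact N.add_mem hx hy
    | smul a x _ hx => rw [smul_comm]; exact N.smul_mem a hx

end Finiteness

section Degree

variable {ι : Type*} [DecidableEq ι] [Fintype ι] {K : Type*} [Field K]

theorem isWeightedHomogeneous_prod_X_pow {κ : Type*} (D : ι → ℕ) (c : ι → κ) :
    (∏ i, X (i, c i) ^ D i : MvPolynomial (ι × κ) K).IsWeightedHomogeneous
      (blockWeight ι κ) D := by
  have h := IsWeightedHomogeneous.prod (R := K) Finset.univ (fun i => X (i, c i) ^ D i)
    (fun i => D i • blockWeight ι κ (i, c i)) (w := blockWeight ι κ)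
    (fun i _ => (isWeightedHomogeneous_X K _ (i, c i)).pow (D i))
  convert h using 1
  ext k
  rw [Finset.sum_apply, Finset.sum_eq_single k]
  · simp
  · intro b _ hb
    simp [Ne.symm hb]
  · simp

theorem exists_not_isAlgebraic_X {σ γ : Type*} [Fintype σ] [Fintype γ]
    (hcard : Fintype.card γ < Fintype.card σ) (g : γ → MvPolynomial σ K) :
    ∃ s, ¬ IsAlgebraic (Algebra.adjoin K (Set.range g)) (X s : MvPolynomial σ K) := by
  by_contra! h
  have halg : Algebra.IsAlgebraic (Algebra.adjoin K (Set.range g)) (MvPolynomial σ K) := by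
    refine ⟨fun f => ?_⟩
    induction f using MvPolynomial.induction_on with
    | C a => exact isAlgebraic_algebraMap (algebraMap K (Algebra.adjoin K (Set.range g)) a)
    | add p q hp hq => exact hp.add hq
    | mul_X p s hp => exact hp.mul (h s)
  classical
  have h1 := Algebra.IsAlgebraic.trdeg_le_cardinalMk K (Set.range g)
  rw [MvPolynomial.trdeg_of_isDomain, Cardinal.mk_fintype, Cardinal.mk_fintype,
    Cardinal.lift_natCast, Nat.cast_le] at h1
  have h2 : Fintype.card (Set.range g) ≤ Fintype.card γ :=
    Fintype.card_le_of_surjective _ Set.rangeFactorization_surjective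
  omega

/-- The multidegree of a morphism from a product of copies of `ℙⁿ` to `ℙⁿ` has
at most one nonzero entry. -/
theorem eq_of_multidegree_ne_zero [IsAlgClosed K] {n : ℕ} (hn : n ≠ 0) {D : ι → ℕ}
    {G : Fin (n + 1) → MvPolynomial (ι × Fin (n + 1)) K}
    (hG : ∀ j, (G j).IsWeightedHomogeneous (blockWeight ι (Fin (n + 1))) D)
    (hG0 : ∀ x : ι → Fin (n + 1) → K, (∀ i, x i ≠ 0) →
      ∃ j, eval (fun p => x p.1 p.2) (G j) ≠ 0)
    {k k' : ι} (hk : D k ≠ 0) (hk' : D k' ≠ 0) : k = k' := by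
  classical
  by_contra hne
  let θ : MvPolynomial (ι × Fin (n + 1)) K →ₐ[K] MvPolynomial (Option (Fin (n + 1))) K :=
    aeval fun p => if p.1 = k then X (some p.2)
      else if p.1 = k' ∧ p.2 = Fin.last n then X none else 1
  have hlast : (0 : Fin (n + 1)) ≠ Fin.last n := by
    intro h
    exact hn (by simpa using (congrArg Fin.val h).symm)
  have hmap : ∀ a ∈ Algebra.adjoin K (Set.range G),
      θ a ∈ Algebra.adjoin K (Set.range (θ ∘ G)) := by
    intro a ha
    rw [Set.range_comp, ← AlgHom.map_adjoin]
    exact ⟨a, ha, rfl⟩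
  have hint : ∀ c : ι → Fin (n + 1), IsAlgebraic (Algebra.adjoin K (Set.range (θ ∘ G)))
      (θ (∏ i, X (i, c i) ^ D i)) := by
    intro c
    have h1 := isIntegral_adjoin_of_isWeightedHomogeneous hG hG0
      (isWeightedHomogeneous_prod_X_pow (K := K) D c)
    exact (h1.map_of_comp_eq (((θ.comp (Subalgebra.val _)).codRestrict
      (Algebra.adjoin K (Set.range (θ ∘ G))) fun a => hmap a a.2).toRingHom)
      θ.toRingHom rfl).isAlgebraic
  have hθ : ∀ c : ι → Fin (n + 1), θ (∏ i, X (i, c i) ^ D i) =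
      X (some (c k)) ^ D k * (if c k' = Fin.last n then X none else 1) ^ D k' := by
    intro c
    rw [map_prod, ← Finset.prod_subset (Finset.subset_univ {k, k'}), Finset.prod_pair hne]
    · simp [θ, Ne.symm hne]
    · intro i _ hi
      simp only [Finset.mem_insert, Finset.mem_singleton, not_or] at hi
      simp [θ, hi.1, hi.2]
  have hsome : ∀ j : Fin (n + 1), IsAlgebraic (Algebra.adjoin K (Set.range (θ ∘ G)))
      (X (some j) ^ D k : MvPolynomial (Option (Fin (n + 1))) K) := by
    intro j
    have h := hint fun i => if i = k then j else 0
    rw [hθ] at h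
    simpa [Ne.symm hne, hlast] using h
  have hnone : IsAlgebraic (Algebra.adjoin K (Set.range (θ ∘ G)))
      (X none : MvPolynomial (Option (Fin (n + 1))) K) := by
    have h := hint fun i => if i = k then 0 else Fin.last n
    rw [hθ] at h
    simp only [if_true, Ne.symm hne, if_false] at h
    exact (IsAlgebraic.of_mul (mem_nonZeroDivisors_of_ne_zero (pow_ne_zero _ (X_ne_zero _)))
      (hsome 0) h).of_pow (Nat.pos_of_ne_zero hk')
  obtain ⟨s, hs⟩ := exists_not_isAlgebraic_X (K := K) (σ := Option (Fin (n + 1))) (by simp) (θ ∘ G)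
  cases s with
  | none => exact hs hnone
  | some j => exact hs ((hsome j).of_pow (Nat.pos_of_ne_zero hk))

end Degree

section Dominant

theorem eval_weightedHomogeneousComponent_eq_zero {ι κ K : Type*} [DecidableEq ι] [Fintype ι]
    [Fintype κ] [Field K] [Infinite K] {P : MvPolynomial (ι × κ) K} {y : ι × κ → K}
    (h : ∀ t : ι → K, eval (fun p => t p.1 * y p) P = 0) (e : ι → ℕ) :
    eval y (weightedHomogeneousComponent (blockWeight ι κ) e P) = 0 := by
  classical
  have hcoeff : ∀ Q : MvPolynomial (ι × κ) K,
      coeff (Finsupp.equivFunOnFinite.symm e)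
        (aeval (fun p => X p.1 * C (y p) : ι × κ → MvPolynomial ι K) Q) =
      eval y (weightedHomogeneousComponent (blockWeight ι κ) e Q) := by
    intro Q
    induction Q using MvPolynomial.induction_on' with
    | add p q hp hq => simp only [map_add, coeff_add, hp, hq]
    | monomial m a =>
      have hX : ∏ p : ι × κ, (X p.1 : MvPolynomial ι K) ^ m p =
          monomial (Finsupp.equivFunOnFinite.symm (Finsupp.weight (blockWeight ι κ) m)) 1 := by
        rw [monomial_eq, Finsupp.prod_fintype _ _ (by simp), C_1, one_mul, Fintype.prod_prod_type]
        refine Finset.prod_congr rfl fun k _ => ?_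
        rw [Finsupp.equivFunOnFinite_symm_apply_apply, weight_blockWeight_apply]
        exact Finset.prod_pow_eq_pow_sum (Finset.univ : Finset κ) (fun j => m (k, j)) (X k : MvPolynomial ι K)
      have hY : ∏ p : ι × κ, (C (y p) : MvPolynomial ι K) ^ m p = C (∏ p, y p ^ m p) := by
        simp
      rw [aeval_monomial, Finsupp.prod_fintype _ _ (by simp)]
      simp only [mul_pow, Finset.prod_mul_distrib]
      rw [hX, hY, mul_comm (monomial _ _), algebraMap_eq, coeff_C_mul, coeff_C_mul, coeff_monomial]
      by_cases hm : Finsupp.weight (blockWeight ι κ) m = e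
      · rw [(isWeightedHomogeneous_monomial _ m a hm).weightedHomogeneousComponent_same,
          eval_monomial, Finsupp.prod_fintype _ _ (by simp), if_pos (by rw [hm]), mul_one]
      · rw [(isWeightedHomogeneous_monomial _ m a rfl).weightedHomogeneousComponent_ne _ (Ne.symm hm),
          if_neg (fun h' => hm (Finsupp.equivFunOnFinite.symm.injective h'))]
        simp
  rw [← hcoeff]
  have h0 : aeval (fun p => X p.1 * C (y p) : ι × κ → MvPolynomial ι K) P = 0 := by
    refine MvPolynomial.funext fun t => ?_
    rw [map_zero, ← h t]
    refine (eval_bind₁_eq t _ P).trans ?_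
    simp
  rw [h0, coeff_zero]

theorem exists_ne_zero_aeval_eq_zero {σ τ K : Type*} [Fintype σ] [Fintype τ] [Field K]
    (hcard : Fintype.card τ < Fintype.card σ) (g : σ → MvPolynomial τ K) :
    ∃ P : MvPolynomial σ K, P ≠ 0 ∧ aeval g P = 0 := by
  by_contra! h
  have hg : AlgebraicIndependent K g :=
    (injective_iff_map_eq_zero _).mpr fun P hP => by_contra fun hP0 => h P hP0 hP
  have h1 := hg.lift_cardinalMk_le_trdeg
  rw [MvPolynomial.trdeg_of_isDomain, Cardinal.mk_fintype, Cardinal.mk_fintype,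
    Cardinal.lift_natCast, Cardinal.lift_natCast, Cardinal.lift_natCast, Nat.cast_le] at h1
  omega

variable {K : Type*} [Field K] {n l : ℕ}

theorem exists_evalAt_mk (v : Fin l → Fin (n + 1) → K) (hv : ∀ i, v i ≠ 0) :
    ∃ a : (Fin l → ℕ) → K, (∀ D, a D ≠ 0) ∧
      ∀ (f : MvPolynomial (Fin l × Fin (n + 1)) K) (D : Fin l → ℕ),
        f.IsWeightedHomogeneous (blockWeight (Fin l) (Fin (n + 1))) D →
        evalAt K (fun i => Projectivization.mk K (v i) (hv i)) f =
          a D * eval (fun p => v p.1 p.2) f := by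
  choose a ha using fun i => Projectivization.exists_smul_eq_mk_rep K (v i) (hv i)
  refine ⟨fun D => ∏ k, (a k : K) ^ D k,
    fun D => Finset.prod_ne_zero_iff.mpr fun k _ => pow_ne_zero _ (a k).ne_zero,
    fun f D hf => ?_⟩
  rw [← eval_mul_block hf (fun k => (a k : K)), evalAt]
  congr 2
  funext p
  rw [← ha]
  rfl

theorem exists_multidegree_ne_zero [Infinite K] (hn : n ≠ 0) (d : Fin l → Fin l → ℕ)
    (F : Fin l → Fin (n + 1) → MvPolynomial (Fin l × Fin (n + 1)) K)
    (homog : ∀ i j, (F i j).IsWeightedHomogeneous (blockWeight (Fin l) (Fin (n + 1))) (d i))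
    (hF : ∀ x : Fin l → (Fin (n + 1) → K), (∀ i, x i ≠ 0) → ∀ i,
      ∃ j, eval (fun p : Fin l × Fin (n + 1) => x p.1 p.2) (F i j) ≠ 0)
    (hdom : ZariskiDense K (Set.range (inducedMap K F hF))) (k₀ : Fin l) :
    ∃ i, d i k₀ ≠ 0 := by
  classical
  by_contra! hk₀
  let τ := Fin l ⊕ ({k : Fin l // k ≠ k₀} × Fin n)
  let ρ : Fin l × Fin (n + 1) → MvPolynomial τ K := fun p =>
    if h : p.1 ≠ k₀ then Fin.cases 1 (fun a => X (Sum.inr (⟨p.1, h⟩, a))) p.2 else 1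
  have hcard : Fintype.card τ < Fintype.card (Fin l × Fin (n + 1)) := by
    have hl : 0 < l := k₀.pos
    simp only [τ, Fintype.card_sum, Fintype.card_prod, Fintype.card_fin, ne_eq,
      Fintype.card_subtype_compl, Fintype.card_subtype_eq]
    have : (l - 1) * n < l * n := Nat.mul_lt_mul_of_pos_right (by omega) (Nat.pos_of_ne_zero hn)
    rw [mul_add, mul_one]
    omega
  obtain ⟨P, hP0, hP⟩ := exists_ne_zero_aeval_eq_zero (K := K) hcard
    (fun p => X (Sum.inl p.1) * bind₁ ρ (F p.1 p.2))
  obtain ⟨m, hm⟩ := ne_zero_iff.mp hP0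
  set e := Finsupp.weight (blockWeight (Fin l) (Fin (n + 1))) m with he
  set Q := weightedHomogeneousComponent (blockWeight (Fin l) (Fin (n + 1))) e P with hQ
  have hQhom : Q.IsWeightedHomogeneous (blockWeight (Fin l) (Fin (n + 1))) e :=
    weightedHomogeneousComponent_isWeightedHomogeneous _ _
  have hQ0 : Q ≠ 0 := by
    refine ne_zero_iff.mpr ⟨m, ?_⟩
    rwa [hQ, coeff_weightedHomogeneousComponent, if_pos he.symm]
  have hchart : ∀ x : Fin l × Fin (n + 1) → K, (∀ k, x (k, 0) = 1) →
      eval x (bind₁ (fun p => F p.1 p.2) Q) = 0 := by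
    intro x hx
    rw [eval_bind₁_eq]
    refine eval_weightedHomogeneousComponent_eq_zero (fun t => ?_) e
    have h1 := congrArg (eval (Sum.elim t fun q => x (q.1.1, q.2.succ))) hP
    rw [← bind₁, eval_bind₁_eq, map_zero] at h1
    rw [← h1]
    congr 2
    funext p
    rw [map_mul, eval_X, Sum.elim_inl, eval_bind₁_eq]
    congr 1
    refine eval_congr_of_block (homog _ _) fun q hq => ?_
    have hqk : q.1 ≠ k₀ := fun h => hq (h ▸ hk₀ p.1)
    obtain ⟨k, a⟩ := q
    simp only [ρ, dif_pos hqk]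
    refine Fin.cases ?_ (fun a => ?_) a
    · simp [hx]
    · simp
  have hcomp : bind₁ (fun p => F p.1 p.2) Q = 0 :=
    eq_zero_of_eval_chart (isWeightedHomogeneous_bind₁ hQhom fun p => homog p.1 p.2) 0 hchart
  have huniv := hdom {x | evalAt K x Q = 0}
    ⟨{Q}, by rintro f rfl; exact ⟨e, hQhom⟩, by simp⟩ (by
      rintro _ ⟨x, rfl⟩
      obtain ⟨a, _, ha⟩ := exists_evalAt_mk (K := K) (fun i j => evalAt K x (F i j)) (fun i h0 => by
        obtain ⟨j, hj⟩ := hF (fun i => (x i).rep) (fun i => (x i).rep_nonzero) i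
        exact hj (congrFun h0 j))
      refine (ha Q e hQhom).trans ?_
      have h1 : eval (fun p : Fin l × Fin (n + 1) => evalAt K x (F p.1 p.2)) Q = 0 := by
        have h2 := eval_bind₁_eq (fun p : Fin l × Fin (n + 1) => (x p.1).rep p.2)
          (fun p : Fin l × Fin (n + 1) => F p.1 p.2) Q
        rw [hcomp, map_zero] at h2
        exact h2.symm
      rw [h1, mul_zero])
  refine hQ0 (eq_zero_of_eval_chart hQhom 0 fun x hx => ?_)
  obtain ⟨a, ha0, ha⟩ := exists_evalAt_mk (K := K) (fun k j => x (k, j)) (fun k h0 => by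
    have := congrFun h0 0
    simp [hx] at this)
  have hall : ∀ y, evalAt K y Q = 0 := Set.eq_univ_iff_forall.mp huniv
  exact (mul_eq_zero.mp ((ha Q e hQhom).symm.trans (hall _))).resolve_left (ha0 e)

end Dominant

section Iterate

theorem subsingleton_projectivization (K ι : Type*) [Field K] [Subsingleton ι] :
    Subsingleton (Projectivization K (ι → K)) := by
  refine ⟨fun x y => ?_⟩
  induction x with | h v hv
  induction y with | h w hw
  obtain ⟨i, hi⟩ := Function.ne_iff.mp hw
  refine (Projectivization.mk_eq_mk_iff' K _ _ _ _).mpr ⟨v i / w i, ?_⟩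
  funext j
  rw [Subsingleton.elim j i]
  exact div_mul_cancel₀ _ hi

variable {K : Type*} [Field K] {n l : ℕ}

/-- The self-map `f` of `(ℙⁿ)^l` is a morphism whose `i`-th component is given by
multihomogeneous polynomials of multidegree `δ i`. -/
def HasMultidegree (f : MPoint K n l → MPoint K n l) (δ : Fin l → Fin l → ℕ) : Prop :=
  ∃ (H : Fin l → Fin (n + 1) → MvPolynomial (Fin l × Fin (n + 1)) K)
    (hH : ∀ x : Fin l → (Fin (n + 1) → K), (∀ i, x i ≠ 0) → ∀ i,
      ∃ j, eval (fun p : Fin l × Fin (n + 1) => x p.1 p.2) (H i j) ≠ 0),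
    (∀ i j, (H i j).IsWeightedHomogeneous (blockWeight (Fin l) (Fin (n + 1))) (δ i)) ∧
      inducedMap K H hH = f

theorem hasMultidegree_id :
    HasMultidegree (id : MPoint K n l → MPoint K n l) fun i => Pi.single i 1 := by
  refine ⟨fun i j => X (i, j), fun x hx i => ?_, fun i j => isWeightedHomogeneous_X _ _ (i, j), ?_⟩
  · simpa using Function.ne_iff.mp (hx i)
  · funext x i
    simp [inducedMap, evalAt]

theorem HasMultidegree.comp {f g : MPoint K n l → MPoint K n l} {δ ε : Fin l → Fin l → ℕ}
    (hf : HasMultidegree f δ) (hg : HasMultidegree g ε) :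
    HasMultidegree (f ∘ g) fun i => ∑ k, δ i k • ε k := by
  obtain ⟨H, hH, Hhom, rfl⟩ := hf
  obtain ⟨G, hG, Ghom, rfl⟩ := hg
  refine ⟨fun i j => bind₁ (fun p => G p.1 p.2) (H i j), fun x hx i => ?_,
    fun i j => isWeightedHomogeneous_bind₁ (Hhom i j) fun p => Ghom p.1 p.2, ?_⟩
  · obtain ⟨j, hj⟩ := hH
      (fun k j => eval (fun p : Fin l × Fin (n + 1) => x p.1 p.2) (G k j))
      (fun k => Function.ne_iff.mpr (hG x hx k)) i
    exact ⟨j, by rwa [eval_bind₁_eq]⟩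
  · funext x i
    obtain ⟨a, ha0, ha⟩ := exists_evalAt_mk (K := K) (fun i j => evalAt K x (G i j))
      (fun i => Function.ne_iff.mpr (hG (fun i => (x i).rep) (fun i => (x i).rep_nonzero) i))
    refine (Projectivization.mk_eq_mk_iff' K _ _ _ _).mpr ⟨(a (δ i))⁻¹, ?_⟩
    funext j
    have h1 : evalAt K (inducedMap K G hG x) (H i j) = _ := ha (H i j) (δ i) (Hhom i j)
    rw [Pi.smul_apply, h1, smul_eq_mul, inv_mul_cancel_left₀ (ha0 _)]
    exact (eval_bind₁_eq (fun p : Fin l × Fin (n + 1) => (x p.1).rep p.2)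
      (fun p : Fin l × Fin (n + 1) => G p.1 p.2) (H i j)).symm

theorem HasMultidegree.iterate {f : MPoint K n l → MPoint K n l} {σ : Equiv.Perm (Fin l)}
    {a : Fin l → ℕ} (ha : ∀ i, 0 < a i)
    (hf : HasMultidegree f fun i => Pi.single (σ i) (a i)) (N : ℕ) :
    ∃ c : Fin l → ℕ, (∀ i, 0 < c i) ∧
      HasMultidegree f^[N] fun i => Pi.single ((σ ^ N) i) (c i) := by
  induction N with
  | zero => exact ⟨fun _ => 1, fun _ => one_pos, hasMultidegree_id⟩
  | succ N ih =>
    obtain ⟨c, hc, h⟩ := ih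
    refine ⟨fun i => c i * a ((σ ^ N) i), fun i => Nat.mul_pos (hc i) (ha _), ?_⟩
    rw [Function.iterate_succ]
    convert h.comp hf using 2 with i
    rw [Finset.sum_eq_single ((σ ^ N) i)]
    · rw [Pi.single_eq_same, ← Pi.single_smul, smul_eq_mul, pow_succ', Equiv.Perm.mul_apply]
    · intro k _ hk
      rw [Pi.single_eq_of_ne hk, zero_smul]
    · simp

end Iterate

/-- Let `𝕐 = (ℙⁿ)^l` and let `ψ : 𝕐 → 𝕐` be a dominant endomorphism,
with components given by multihomogeneous polynomials `F i` of multidegree `d i`.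
Then there is some `N ≥ 1` such that the iterate `ψ^N` is again a morphism `𝕐 → 𝕐`,
whose `i`-th component has multidegree `c i • E_i` for positive integers `c i`; i.e.
`(ψ^N)* E_i = c_i • E_i`, so `(ψ^N)*` is a diagonal matrix in the basis `E_1, …, E_l`. -/
theorem iterate_pullback_diagonal (K : Type*) [Field K] [IsAlgClosed K]
    {n l : ℕ} (d : Fin l → Fin l → ℕ)
    (F : Fin l → Fin (n + 1) → MvPolynomial (Fin l × Fin (n + 1)) K)
    (homog : ∀ i j, (F i j).IsWeightedHomogeneous
      (fun p : Fin l × Fin (n + 1) => Pi.single p.1 (1 : ℕ)) (d i))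
    (hF : ∀ x : Fin l → (Fin (n + 1) → K), (∀ i, x i ≠ 0) → ∀ i,
      ∃ j, eval (fun p : Fin l × Fin (n + 1) => x p.1 p.2) (F i j) ≠ 0)
    (hdom : ZariskiDense K (Set.range (inducedMap K F hF))) :
    ∃ N : ℕ, 1 ≤ N ∧ ∃ c : Fin l → ℕ, (∀ i, 0 < c i) ∧
      ∃ (H : Fin l → Fin (n + 1) → MvPolynomial (Fin l × Fin (n + 1)) K)
        (hH : ∀ x : Fin l → (Fin (n + 1) → K), (∀ i, x i ≠ 0) → ∀ i,
          ∃ j, eval (fun p : Fin l × Fin (n + 1) => x p.1 p.2) (H i j) ≠ 0),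
        (∀ i j, (H i j).IsWeightedHomogeneous
          (fun p : Fin l × Fin (n + 1) => Pi.single p.1 (1 : ℕ)) ((Pi.single i (c i) : Fin l → ℕ))) ∧
        inducedMap K H hH = (inducedMap K F hF)^[N] := by
  suffices h : ∃ (σ : Equiv.Perm (Fin l)) (a : Fin l → ℕ), (∀ i, 0 < a i) ∧
      HasMultidegree (inducedMap K F hF) fun i => Pi.single (σ i) (a i) by
    obtain ⟨σ, a, ha, hψ⟩ := h
    obtain ⟨c, hc, H, hH, Hhom, hind⟩ := hψ.iterate ha (orderOf σ)
    refine ⟨orderOf σ, orderOf_pos σ, c, hc, H, hH, fun i j => ?_, hind⟩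
    simpa [pow_orderOf_eq_one] using Hhom i j
  rcases eq_or_ne n 0 with rfl | hn
  · have : Subsingleton (Fin (0 + 1)) := Fin.subsingleton_one
    have := subsingleton_projectivization K (Fin (0 + 1))
    rw [Subsingleton.elim (inducedMap K F hF) id]
    exact ⟨1, fun _ => 1, fun _ => one_pos, hasMultidegree_id⟩
  choose τ hτ using exists_multidegree_ne_zero hn d F homog hF hdom
  have huniq : ∀ i k k', d i k ≠ 0 → d i k' ≠ 0 → k = k' := fun i k k' =>
    eq_of_multidegree_ne_zero hn (homog i) fun x hx => hF x hx i
  have hinj : Function.Injective τ := fun k k' h => huniq _ k k' (hτ k) (h ▸ hτ k')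
  let σ := (Equiv.ofBijective τ (Finite.injective_iff_bijective.mp hinj)).symm
  have hσ : ∀ i, d i (σ i) ≠ 0 := by
    intro i
    have h := hτ (σ i)
    rwa [show τ (σ i) = i from Equiv.ofBijective_apply_symm_apply τ _ i] at h
  refine ⟨σ, fun i => d i (σ i), fun i => Nat.pos_of_ne_zero (hσ i), F, hF, fun i j => ?_, rfl⟩
  convert homog i j
  ext k
  by_cases hk : k = σ i
  · simp [hk]
  · refine (Pi.single_eq_of_ne hk _).trans ?_
    exact (not_ne_iff.mp fun h => hk (huniq i _ _ h (hσ i))).symm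
end

section
/- Let 𝕏 = ℙ^{n_1} × ⋯ × ℙ^{n_k} with n_1 ≤ n_2 ≤ ⋯ ≤ n_k and let φ : 𝕏 → 𝕏 be an endomorphism. Writing φ*E_u = ∑_{v} d_{uv} E_v, one has d_{uv} = 0 whenever n_v > n_u; that is, the matrix of φ* in the basis E_1, …, E_k (with factors grouped by equal dimension) is block upper-triangular. -/
/-!
An endomorphism `φ` of `𝕏 = ℙ^{n 0} × ⋯ × ℙ^{n (k-1)}` over an algebraically closed
field `K` is given by components `φ_u : 𝕏 → ℙ^{n u}`, each described by `n u + 1`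
polynomials `F u j` in the blocks of variables `X_i = (X_{i,0}, …, X_{i,n i})`,
multihomogeneous of a common multidegree `d u : Fin k → ℕ` (so that
`φ*E_u = ∑_v (d u v) • E_v` in `Pic(𝕏)`), with no common zero on `𝕏`.
-/

namespace MvPolynomial

/-- The prime ideal of polynomials vanishing on the coordinate subspace where the variables in `s`
are zero has height at least `#s`. -/
lemma card_le_height_ker_aeval_ite {σ K : Type*} [Field K] [DecidableEq σ] (s : Finset σ) :
    (s.card : ℕ∞) ≤ (RingHom.ker
      (aeval fun i => if i ∈ s then 0 else X i : MvPolynomial σ K →ₐ[K] MvPolynomial σ K)).height := by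
  induction s using Finset.induction_on with
  | empty => simp
  | insert a s ha ih =>
    set f : MvPolynomial σ K →ₐ[K] MvPolynomial σ K := aeval fun i => if i ∈ s then 0 else X i
    set g : MvPolynomial σ K →ₐ[K] MvPolynomial σ K :=
      aeval fun i => if i ∈ insert a s then 0 else X i
    have hgf : g.comp f = g := by
      ext1 i
      by_cases hi : i ∈ s <;> simp [f, g, hi]
    have hle : RingHom.ker f ≤ RingHom.ker g := fun p hp => by
      rw [RingHom.mem_ker] at hp ⊢
      rw [← hgf, AlgHom.comp_apply, hp, map_zero]
    have hlt : RingHom.ker f < RingHom.ker g := by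
      refine lt_of_le_not_ge hle fun h => ?_
      have hX : (X a : MvPolynomial σ K) ∈ RingHom.ker g := by simp [RingHom.mem_ker, g]
      simpa [RingHom.mem_ker, f, ha] using h hX
    have : (RingHom.ker f).IsPrime := RingHom.ker_isPrime _
    have : (RingHom.ker g).IsPrime := RingHom.ker_isPrime _
    rw [Finset.card_insert_of_notMem ha, Nat.cast_add, Nat.cast_one]
    exact (add_le_add_left ih 1).trans (Ideal.height_add_one_le_of_lt_of_isPrime hlt)

lemma card_le_height_vanishingIdeal_zero {σ K : Type*} [Field K] [Fintype σ] :
    (Fintype.card σ : ℕ∞) ≤ (vanishingIdeal K {(0 : σ → K)}).height := by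
  classical
  refine (card_le_height_ker_aeval_ite (K := K) (Finset.univ : Finset σ)).trans
    (Ideal.height_mono fun p hp => ?_)
  rw [RingHom.mem_ker] at hp
  rw [mem_vanishingIdeal_singleton_iff]
  have h := congrArg (aeval (0 : σ → K)) hp
  rw [map_zero, ← AlgHom.comp_apply, comp_aeval] at h
  convert! h using 3
  ext i
  simp

/-- Over an algebraically closed field, fewer polynomials than variables, all vanishing at the
origin, have a common zero other than the origin. -/
theorem exists_ne_zero_forall_eval_eq_zero {ι σ K : Type*} [Field K] [IsAlgClosed K] [Fintype ι]
    [Fintype σ] (hcard : Fintype.card ι < Fintype.card σ) (f : ι → MvPolynomial σ K)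
    (hf : ∀ i, eval 0 (f i) = 0) : ∃ x : σ → K, x ≠ 0 ∧ ∀ i, eval x (f i) = 0 := by
  by_contra! h
  have hI : Ideal.span (Set.range f) ≤ vanishingIdeal K {(0 : σ → K)} := by
    rw [Ideal.span_le]
    rintro _ ⟨i, rfl⟩
    simpa [aeval_eq_eval] using hf i
  have hrad : vanishingIdeal K {(0 : σ → K)} ≤ (Ideal.span (Set.range f)).radical := by
    rw [← vanishingIdeal_zeroLocus_eq_radical (K := K)]
    refine vanishingIdeal_anti_mono fun x hx => ?_
    by_contra hx0
    obtain ⟨i, hi⟩ := h x hx0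
    exact hi (by simpa [aeval_eq_eval] using hx (f i) (Ideal.subset_span ⟨i, rfl⟩))
  have hmin : vanishingIdeal K {(0 : σ → K)} ∈ (Ideal.span (Set.range f)).minimalPrimes :=
    ⟨⟨inferInstance, hI⟩, fun Q hQ _ => hrad.trans (hQ.1.radical_le_iff.2 hQ.2)⟩
  have hle := card_le_height_vanishingIdeal_zero.trans
    (Ideal.height_le_card_of_mem_minimalPrimes_span (Set.finite_range f) hmin)
  rw [Nat.cast_le, ← Nat.card_coe_set_eq] at hle
  have hrange := Finite.card_range_le f
  rw [Nat.card_eq_fintype_card (α := ι)] at hrange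
  exact absurd (hle.trans hrange) hcard.not_ge

/-- A multihomogeneous polynomial of positive degree in the block `v` vanishes wherever all
variables of this block are zero. -/
lemma eval_eq_zero_of_isWeightedHomogeneous_single {ι R : Type*} [CommSemiring R] [DecidableEq ι]
    {β : ι → Type*} {p : MvPolynomial (Σ i, β i) R} {d : ι → ℕ}
    (hp : p.IsWeightedHomogeneous (fun q : Σ i, β i => Pi.single q.1 (1 : ℕ)) d) {v : ι}
    (hv : d v ≠ 0) {x : (Σ i, β i) → R} (hx : ∀ j, x ⟨v, j⟩ = 0) : eval x p = 0 := by
  rw [eval_eq]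
  refine Finset.sum_eq_zero fun m hm => ?_
  have hw := congrFun (hp (mem_support_iff.1 hm)) v
  rw [Finsupp.weight_apply, Finsupp.sum, Finset.sum_apply] at hw
  obtain ⟨⟨i, j⟩, hq, hne⟩ := Finset.exists_ne_zero_of_sum_ne_zero (hw.trans_ne hv)
  obtain rfl : i = v := by
    by_contra hi
    exact hne (by simp [Pi.single_eq_of_ne (Ne.symm hi)])
  rw [Finset.prod_eq_zero hq (by rw [hx, zero_pow (Finsupp.mem_support_iff.1 hq)]), mul_zero]

end MvPolynomial

/-- Let `𝕏 = ℙ^{n_1} × ⋯ × ℙ^{n_k}` with `n_1 ≤ n_2 ≤ ⋯ ≤ n_k` and let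
`φ : 𝕏 → 𝕏` be an endomorphism.  Writing `φ*E_u = ∑_v d_{uv} E_v`, one has `d_{uv} = 0`
whenever `n_v > n_u`; that is, the matrix of `φ*` in the basis `E_1, …, E_k` (with the
factors grouped by equal dimension) is block upper-triangular. -/
theorem pullback_matrix_block_upper_triangular (K : Type*) [Field K] [IsAlgClosed K]
    {k : ℕ} (n : Fin k → ℕ) (hsorted : Monotone n)
    (d : Fin k → Fin k → ℕ)
    (F : (u : Fin k) → Fin (n u + 1) → MvPolynomial (Σ i : Fin k, Fin (n i + 1)) K)
    (homog : ∀ u j, (F u j).IsWeightedHomogeneous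
      (fun p : Σ i : Fin k, Fin (n i + 1) => Pi.single p.1 (1 : ℕ)) (d u))
    (nonvanishing : ∀ x : (i : Fin k) → (Fin (n i + 1) → K), (∀ i, x i ≠ 0) → ∀ u,
      ∃ j, MvPolynomial.eval (fun p : Σ i : Fin k, Fin (n i + 1) => x p.1 p.2) (F u j) ≠ 0) :
    ∀ u v : Fin k, n u < n v → d u v = 0 := by
  intro u v huv
  by_contra hd
  let e : (i : Fin k) → Fin (n i + 1) → K := fun i => Pi.single 0 1
  let y : (Fin (n v + 1) → K) → (i : Fin k) → Fin (n i + 1) → K := Function.update e v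
  let G : Fin (n u + 1) → MvPolynomial (Fin (n v + 1)) K := fun j =>
    MvPolynomial.aeval (fun p : Σ i : Fin k, Fin (n i + 1) =>
      Function.update (fun i l => MvPolynomial.C (e i l)) v MvPolynomial.X p.1 p.2) (F u j)
  have hG : ∀ x j, MvPolynomial.eval x (G j) =
      MvPolynomial.eval (fun p : Σ i : Fin k, Fin (n i + 1) => y x p.1 p.2) (F u j) := by
    intro x j
    simp only [G, ← MvPolynomial.aeval_eq_eval]
    rw [← AlgHom.comp_apply, MvPolynomial.comp_aeval]
    congr 2
    ext ⟨i, l⟩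
    by_cases hi : i = v
    · subst hi
      simp [y]
    · simp [y, hi]
  obtain ⟨x, hx0, hx⟩ := MvPolynomial.exists_ne_zero_forall_eval_eq_zero (by simpa using huv) G
    fun j => by
      rw [hG]
      exact MvPolynomial.eval_eq_zero_of_isWeightedHomogeneous_single (homog u j) hd
        (by simp [y])
  obtain ⟨j, hj⟩ := nonvanishing (y x) (fun i => by
    by_cases hi : i = v
    · subst hi
      simpa [y] using hx0
    · simp [y, hi, e]) u
  exact hj ((hG x j).symm.trans (hx j))
end
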